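/- For every finite simple graph G and every vertex w of G, min-match_{K2,C5}(G − w) ≤ min-match_{K2,C5}(G), i.e., deleting a vertex does not increase the minimum {K2,C5}-matching number. -/

import Mathlib

open SimpleGraph

namespace Paper

/-- The complete graph on two vertices, `K₂`. -/
def k2 : SimpleGraph (Fin 2) := ⊤

/-- The 5-cycle `C₅`. -/
def cycle5 : SimpleGraph (ZMod 5) := SimpleGraph.fromRel (fun a b => b = a + 1)

/-- A graph is chordal if it has no induced cycle of length at least four. -/
def IsChordal {V : Type*} (G : SimpleGraph V) : Prop :=
  ∀ n : ℕ, 4 ≤ n → IsEmpty (SimpleGraph.cycleGraph n ↪g G)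

/-- A graph is co-chordal if its complement is chordal. -/
def IsCochordal {V : Type*} (G : SimpleGraph V) : Prop := IsChordal Gᶜ

/-- The co-chordal cover number: the minimum number of co-chordal subgraphs of `G`
needed to cover all edges of `G`. -/
noncomputable def cochord {V : Type*} (G : SimpleGraph V) : ℕ :=
  sInf { t | ∃ f : Fin t → SimpleGraph V,
    (∀ i, f i ≤ G ∧ IsCochordal (f i)) ∧ ∀ ⦃u v : V⦄, G.Adj u v → ∃ i, (f i).Adj u v }

/-- The closed neighborhood `N_G[w]`. -/
def closedNbhd {V : Type*} (G : SimpleGraph V) (w : V) : Set V :=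
  insert w (G.neighborSet w)

/-- The graph `G - N_G[w]`: the induced subgraph on the complement of the closed
neighborhood of `w`. -/
def delClosedNbhd {V : Type*} (G : SimpleGraph V) (w : V) :
    SimpleGraph ((closedNbhd G w)ᶜ : Set V) := G.induce _

/-- A maximal matching: a matching such that no edge of `G` is disjoint from all of
its edges. -/
def IsMaximalMatching {V : Type*} (G : SimpleGraph V) (M : G.Subgraph) : Prop :=
  M.IsMatching ∧ ∀ ⦃u v : V⦄, G.Adj u v → u ∈ M.support ∨ v ∈ M.support

/-- The minimum matching number: the minimum cardinality of a maximal matching. -/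
noncomputable def minMatch {V : Type*} (G : SimpleGraph V) : ℕ :=
  sInf { k | ∃ M : G.Subgraph, IsMaximalMatching G M ∧ M.edgeSet.ncard = k }

/-- The matching number of a graph: maximum cardinality of a matching. -/
noncomputable def matchNum {V : Type*} (G : SimpleGraph V) : ℕ :=
  sSup { k | ∃ M : G.Subgraph, M.IsMatching ∧ M.edgeSet.ncard = k }

/-- A graph all of whose connected components are isomorphic to `K₂` or `C₅`. -/
def IsK2C5Graph {V : Type*} (G : SimpleGraph V) : Prop :=
  ∀ c : G.ConnectedComponent,
    Nonempty (G.induce c.supp ≃g k2) ∨ Nonempty (G.induce c.supp ≃g cycle5)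

/-- A maximal `{K₂, C₅}`-subgraph of `G`: a subgraph whose components are all `K₂` or
`C₅` such that the induced subgraph of `G` on the vertices outside it has no edge. -/
def IsMaximalK2C5Subgraph {V : Type*} (G : SimpleGraph V) (H : G.Subgraph) : Prop :=
  IsK2C5Graph H.coe ∧ ∀ ⦃u v : V⦄, G.Adj u v → u ∈ H.verts ∨ v ∈ H.verts

/-- `min-match_{K₂,C₅}(G)`: the minimum matching number of a maximal
`{K₂, C₅}`-subgraph of `G` (with value `0` if `G` has no edge, via `sInf ∅ = 0`:
if `G` is edgeless the empty subgraph is a maximal `{K₂,C₅}`-subgraph). -/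
noncomputable def minMatchK2C5 {V : Type*} (G : SimpleGraph V) : ℕ :=
  sInf { k | ∃ H : G.Subgraph, IsMaximalK2C5Subgraph G H ∧ matchNum H.coe = k }

/-- An induced matching of `G`. -/
def IsInducedMatching {V : Type*} (G : SimpleGraph V) (M : G.Subgraph) : Prop :=
  M.IsMatching ∧ ∀ ⦃u v : V⦄, G.Adj u v → u ∈ M.support → v ∈ M.support → M.Adj u v

/-- The induced matching number of `G`. -/
noncomputable def indMatch {V : Type*} (G : SimpleGraph V) : ℕ :=
  sSup { k | ∃ M : G.Subgraph, IsInducedMatching G M ∧ M.edgeSet.ncard = k }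

/-- `ind-match_{K₂,C₅}(G)`: the maximum matching number of an induced subgraph of `G`
all of whose connected components are `K₂` or `C₅`. -/
noncomputable def indMatchK2C5 {V : Type*} (G : SimpleGraph V) : ℕ :=
  sSup { k | ∃ s : Set V, IsK2C5Graph (G.induce s) ∧ matchNum (G.induce s) = k }

/-- `v` lies in the range of an induced copy of `K` in `G` which is closed under adjacency. -/
def InCopy {U V : Type*} (K : SimpleGraph U) (G : SimpleGraph V) (v : V) : Prop :=
  ∃ e : K ↪g G, v ∈ Set.range e ∧ ∀ i x, G.Adj (e i) x → x ∈ Set.range e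

lemma mem_of_reachable_of_closed {V : Type*} {G : SimpleGraph V} {S : Set V}
    (hS : ∀ a b, a ∈ S → G.Adj a b → b ∈ S) {a b : V} (h : G.Reachable a b) (ha : a ∈ S) :
    b ∈ S := by
  obtain ⟨p⟩ := h
  induction p with
  | nil => exact ha
  | cons hadj _ ih => exact ih (hS _ _ ha hadj)

lemma inCopy_iff {U V : Type*} {K : SimpleGraph U} (hK : K.Preconnected) {G : SimpleGraph V}
    {v : V} :
    InCopy K G v ↔ Nonempty (G.induce (G.connectedComponentMk v).supp ≃g K) := by
  constructor
  · rintro ⟨e, ⟨i, rfl⟩, hc⟩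
    have hr : Set.range e = (G.connectedComponentMk (e i)).supp := by
      ext x
      rw [ConnectedComponent.mem_supp_iff, ConnectedComponent.eq]
      constructor
      · rintro ⟨j, rfl⟩
        exact (hK j i).map e.toHom
      · intro h
        refine mem_of_reachable_of_closed (S := Set.range e) ?_ h.symm ⟨i, rfl⟩
        rintro _ b ⟨j, rfl⟩ hab
        exact hc j b hab
    rw [← hr]
    exact ⟨(⟨Equiv.ofInjective e e.injective, by simp⟩ :
      K ≃g G.induce (Set.range e)).symm⟩
  · rintro ⟨φ⟩
    refine ⟨φ.symm.toEmbedding.trans (Embedding.induce _), ⟨φ ⟨v, rfl⟩, ?_⟩, ?_⟩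
    · simp
    · intro i x h
      have hx : x ∈ (G.connectedComponentMk v).supp :=
        ConnectedComponent.mem_supp_of_adj_mem_supp _ (φ.symm i).2 h
      exact ⟨φ ⟨x, hx⟩, by simp⟩

lemma InCopy.map {U V W : Type*} {K : SimpleGraph U} {G : SimpleGraph V} {G' : SimpleGraph W}
    (φ : G ↪g G') (hφ : ∀ a y, G'.Adj (φ a) y → y ∈ Set.range φ) {v : V} (h : InCopy K G v) :
    InCopy K G' (φ v) := by
  obtain ⟨e, ⟨i, rfl⟩, hc⟩ := h
  refine ⟨e.trans φ, ⟨i, rfl⟩, fun j x hx => ?_⟩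
  obtain ⟨y, rfl⟩ := hφ _ _ hx
  obtain ⟨k, rfl⟩ := hc j y (φ.map_adj_iff.1 hx)
  exact ⟨k, rfl⟩

lemma InCopy.comap {U V W : Type*} {K : SimpleGraph U} (hK : K.Preconnected)
    {G : SimpleGraph V} {G' : SimpleGraph W}
    (φ : G ↪g G') (hφ : ∀ a y, G'.Adj (φ a) y → y ∈ Set.range φ) {v : V}
    (h : InCopy K G' (φ v)) : InCopy K G v := by
  obtain ⟨e, ⟨i, hi⟩, hc⟩ := h
  have hr : ∀ j, ∃ a, φ a = e j := fun j =>
    mem_of_reachable_of_closed (S := Set.range φ)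
      (by rintro _ b ⟨a, rfl⟩ hab; exact hφ a b hab) ((hK i j).map e.toHom) ⟨v, hi.symm⟩
  choose g hg using hr
  refine ⟨⟨⟨g, fun a b hab => e.injective (by rw [← hg, ← hg, hab])⟩, ?_⟩,
    ⟨i, φ.injective ((hg i).trans hi)⟩, fun j x hx => ?_⟩
  · intro a b
    change G.Adj (g a) (g b) ↔ _
    rw [← φ.map_adj_iff, hg, hg, e.map_adj_iff]
  · obtain ⟨k, hk⟩ := hc j (φ x) (by rw [← hg]; exact φ.map_adj_iff.2 hx)
    exact ⟨k, φ.injective ((hg k).trans hk)⟩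

lemma InCopy.congr_off {U V : Type*} {K : SimpleGraph U} (hK : K.Preconnected)
    {G G' : SimpleGraph V} {S : Set V} (hS : ∀ a b, a ∈ S → G.Adj a b → b ∈ S)
    (hG : ∀ a b, a ∉ S → (G'.Adj a b ↔ G.Adj a b)) {v : V} (hv : v ∉ S)
    (h : InCopy K G v) : InCopy K G' v := by
  obtain ⟨e, ⟨i, rfl⟩, hc⟩ := h
  have hr : ∀ j, e j ∉ S := fun j hj =>
    hv (mem_of_reachable_of_closed hS ((hK j i).map e.toHom) hj)
  refine ⟨⟨e.toEmbedding, ?_⟩, ⟨i, rfl⟩, fun j x hx => ?_⟩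
  · intro a b
    exact (hG _ _ (hr a)).trans e.map_adj_iff
  · exact hc j x ((hG _ _ (hr j)).1 hx)

lemma inCopy_k2 {V : Type*} {G : SimpleGraph V} {u v : V}
    (hu : ∀ x, G.Adj u x ↔ x = v) (hv : ∀ x, G.Adj v x ↔ x = u) : InCopy k2 G u := by
  have huv : G.Adj u v := (hu v).2 rfl
  refine ⟨⟨⟨![u, v], ?_⟩, ?_⟩, ⟨0, rfl⟩, ?_⟩
  · intro i j
    fin_cases i <;> fin_cases j <;> simp [huv.ne, huv.ne']
  · intro i j
    change G.Adj (![u, v] i) (![u, v] j) ↔ _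
    fin_cases i <;> fin_cases j <;> simp [k2, huv, huv.symm]
  · intro i x hx
    fin_cases i
    · exact ⟨1, ((hu x).1 hx).symm⟩
    · exact ⟨0, ((hv x).1 hx).symm⟩

lemma k2_preconnected : k2.Preconnected := preconnected_top

lemma cycle5_adj_succ (i : ZMod 5) : cycle5.Adj i (i + 1) := by
  rw [cycle5, fromRel_adj]
  exact ⟨by revert i; decide, Or.inl rfl⟩

lemma cycle5_preconnected : cycle5.Preconnected := by
  have h (i : ZMod 5) : cycle5.Reachable 0 i := by
    have key (n : ℕ) : cycle5.Reachable 0 (n : ZMod 5) := by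
      induction n with
      | zero => simp
      | succ n ih =>
        rw [Nat.cast_succ]
        exact ih.trans (cycle5_adj_succ _).reachable
    obtain ⟨n, rfl⟩ := ZMod.natCast_zmod_surjective i
    exact key n
  exact fun i j => (h i).symm.trans (h j)

lemma isK2C5Graph_iff {V : Type*} {G : SimpleGraph V} :
    IsK2C5Graph G ↔ ∀ v, InCopy k2 G v ∨ InCopy cycle5 G v := by
  simp only [inCopy_iff k2_preconnected, inCopy_iff cycle5_preconnected]
  exact ⟨fun h v => h _, fun h c => c.ind h⟩

/-- The inclusion of `H.coe` into `H.spanningCoe`. -/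
def coeEmbedding {V : Type*} {G : SimpleGraph V} (H : G.Subgraph) :
    H.coe ↪g H.spanningCoe := ⟨⟨Subtype.val, Subtype.val_injective⟩, Iff.rfl⟩

lemma isK2C5Graph_coe_iff {V : Type*} {G : SimpleGraph V} {H : G.Subgraph} :
    IsK2C5Graph H.coe ↔
      ∀ v ∈ H.verts, InCopy k2 H.spanningCoe v ∨ InCopy cycle5 H.spanningCoe v := by
  have hφ : ∀ a y, H.spanningCoe.Adj (coeEmbedding H a) y → y ∈ Set.range (coeEmbedding H) :=
    fun a y h => ⟨⟨y, H.edge_vert h.symm⟩, rfl⟩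
  rw [isK2C5Graph_iff]
  constructor
  · exact fun h v hv => (h ⟨v, hv⟩).imp (InCopy.map _ hφ) (InCopy.map _ hφ)
  · exact fun h v => (h v v.2).imp (InCopy.comap k2_preconnected _ hφ)
      (InCopy.comap cycle5_preconnected _ hφ)

/-- Replace the part of `H` lying in a union `S` of components by a matching `N` in `S`. -/
lemma exists_replace {V : Type*} {G : SimpleGraph V} {H : G.Subgraph} (hH : IsK2C5Graph H.coe)
    {S : Set V} (hS : ∀ a b, a ∈ S → H.Adj a b → b ∈ S) {N : G.Subgraph} (hN : N.IsMatching)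
    (hNS : N.verts ⊆ S) :
    ∃ H' : G.Subgraph, IsK2C5Graph H'.coe ∧ H'.verts = H.verts \ S ∪ N.verts ∧
      ∀ a b, H'.Adj a b ↔ (H.Adj a b ∧ a ∉ S) ∨ N.Adj a b := by
  let H' : G.Subgraph :=
    { verts := H.verts \ S ∪ N.verts
      Adj := fun a b => (H.Adj a b ∧ a ∉ S) ∨ N.Adj a b
      adj_sub := by
        rintro a b (⟨h, -⟩ | h)
        exacts [h.adj_sub, h.adj_sub]
      edge_vert := by
        rintro a b (⟨h, ha⟩ | h)
        exacts [Or.inl ⟨H.edge_vert h, ha⟩, Or.inr (N.edge_vert h)]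
      symm := ⟨by
        rintro a b (⟨h, ha⟩ | h)
        exacts [Or.inl ⟨h.symm, fun hb => ha (hS _ _ hb h.symm)⟩, Or.inr h.symm]⟩ }
  refine ⟨H', isK2C5Graph_coe_iff.2 ?_, rfl, fun _ _ => Iff.rfl⟩
  rintro v (⟨hv, hvS⟩ | hv)
  · have hG : ∀ a b, a ∉ S → (H'.spanningCoe.Adj a b ↔ H.spanningCoe.Adj a b) := fun a b ha =>
      ⟨fun h => h.elim And.left fun h => absurd (hNS (N.edge_vert h)) ha,
        fun h => Or.inl ⟨h, ha⟩⟩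
    exact (isK2C5Graph_coe_iff.1 hH v hv).imp (InCopy.congr_off k2_preconnected hS hG hvS)
      (InCopy.congr_off cycle5_preconnected hS hG hvS)
  · have key : ∀ a b, N.Adj a b → ∀ x, H'.spanningCoe.Adj a x ↔ x = b := by
      intro a b hab x
      have ha : a ∈ S := hNS (N.edge_vert hab)
      constructor
      · rintro (⟨-, h⟩ | h)
        exacts [absurd ha h, (hN (N.edge_vert hab)).unique h hab]
      · rintro rfl
        exact Or.inr hab
    obtain ⟨u, hu, -⟩ := hN hv
    exact Or.inl (inCopy_k2 (key _ _ hu) (key _ _ hu.symm))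

lemma isMatching_bot {V : Type*} (G : SimpleGraph V) : (⊥ : G.Subgraph).IsMatching :=
  fun _ h => h.elim

lemma exists_isMaximalK2C5Subgraph {V : Type*} [Finite V] (G : SimpleGraph V) :
    ∃ H : G.Subgraph, IsMaximalK2C5Subgraph G H := by
  have hbot : IsK2C5Graph (⊥ : G.Subgraph).coe := isK2C5Graph_coe_iff.2 fun v hv => hv.elim
  obtain ⟨H, hH, hmax⟩ := Set.Finite.exists_maximalFor (fun H : G.Subgraph => H.verts.ncard)
    {H | IsK2C5Graph H.coe} (Set.toFinite _) ⟨⊥, hbot⟩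
  refine ⟨H, hH, fun u v huv => ?_⟩
  by_contra! hnot
  obtain ⟨H', hH', hverts, -⟩ := exists_replace hH (S := {u, v})
    (by
      rintro a b (rfl | rfl) hab
      exacts [absurd (H.edge_vert hab) hnot.1, absurd (H.edge_vert hab) hnot.2])
    (Subgraph.IsMatching.subgraphOfAdj huv) subset_rfl
  have hlt : H.verts ⊂ H'.verts := by
    refine ⟨fun a ha => ?_, fun h => hnot.1 (h ?_)⟩
    · rw [hverts]
      refine Or.inl ⟨ha, ?_⟩
      rintro (rfl | rfl)
      exacts [hnot.1 ha, hnot.2 ha]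
    · rw [hverts]
      exact Or.inr (Or.inl rfl)
  have h1 := Set.ncard_lt_ncard hlt (Set.toFinite _)
  exact absurd (hmax hH' h1.le) (not_le.2 h1)

lemma matchNum_le_of_injective {V W : Type*} [Finite W] {G : SimpleGraph V}
    {G' : SimpleGraph W} (f : G →g G') (hf : Function.Injective f) :
    matchNum G ≤ matchNum G' := by
  refine csSup_le ⟨_, ⟨⊥, isMatching_bot G, rfl⟩⟩ ?_
  rintro _ ⟨M, hM, rfl⟩
  have hb : BddAbove {k | ∃ M : G'.Subgraph, M.IsMatching ∧ M.edgeSet.ncard = k} := by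
    refine ⟨(Set.univ : Set (Sym2 W)).ncard, ?_⟩
    rintro _ ⟨M, -, rfl⟩
    exact Set.ncard_le_ncard (Set.subset_univ _) (Set.toFinite _)
  refine le_csSup hb ⟨M.map f, hM.map f hf, ?_⟩
  rw [Subgraph.edgeSet_map]
  exact Set.ncard_image_of_injective _ (Sym2.map.injective hf)

/-- A `{K₂, C₅}`-subgraph `H'` avoiding `w` which covers every edge of `G - w` and maps
injectively into `H` bounds the minimum `{K₂, C₅}`-matching number of `G - w`. -/
lemma minMatchK2C5_induce_le {V : Type*} [Finite V] {G : SimpleGraph V} {w : V}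
    {H H' : G.Subgraph} (hH' : IsK2C5Graph H'.coe) (hw : w ∉ H'.verts)
    (hcov : ∀ u v, G.Adj u v → u ≠ w → v ≠ w → u ∈ H'.verts ∨ v ∈ H'.verts)
    (f : V → V) (hf : Set.InjOn f H'.verts) (hfv : Set.MapsTo f H'.verts H.verts)
    (hadj : ∀ a b, H'.Adj a b → H.Adj (f a) (f b)) :
    minMatchK2C5 (G.induce ({w}ᶜ : Set V)) ≤ matchNum H.coe := by
  let ι : G.induce ({w}ᶜ : Set V) ↪g G := Embedding.induce _
  let D := H'.comap ι.toHom
  let φ : D.spanningCoe ↪g H'.spanningCoe :=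
    ⟨ι.toEmbedding, fun {a b} => ⟨fun h => ⟨h.adj_sub, h⟩, fun h => h.2⟩⟩
  have hφ : ∀ a y, H'.spanningCoe.Adj (φ a) y → y ∈ Set.range φ := fun a y h =>
    ⟨⟨y, fun hy => hw (hy ▸ H'.edge_vert h.symm)⟩, rfl⟩
  have hD : IsMaximalK2C5Subgraph (G.induce ({w}ᶜ : Set V)) D :=
    ⟨isK2C5Graph_coe_iff.2 fun v hv => (isK2C5Graph_coe_iff.1 hH' v hv).imp
      (InCopy.comap k2_preconnected φ hφ) (InCopy.comap cycle5_preconnected φ hφ),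
      fun u v huv => hcov u v huv u.2 v.2⟩
  refine le_trans (b := matchNum D.coe) (Nat.sInf_le ⟨D, hD, rfl⟩) ?_
  refine matchNum_le_of_injective ⟨fun a => ⟨f a, hfv a.2⟩, fun {a b} h => hadj _ _ h.2⟩ ?_
  intro a b hab
  exact Subtype.ext (Subtype.ext (hf a.2 b.2 (congrArg Subtype.val hab)))

lemma minMatchK2C5_induce_le_of_inCopy_k2 {V : Type*} [Finite V] {G : SimpleGraph V} {w : V}
    {H : G.Subgraph} (hH : IsMaximalK2C5Subgraph G H) (hw : InCopy k2 H.spanningCoe w) :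
    minMatchK2C5 (G.induce ({w}ᶜ : Set V)) ≤ matchNum H.coe := by
  classical
  obtain ⟨x, hwx, hx⟩ : ∃ x, H.Adj w x ∧ ∀ a b, (a = w ∨ a = x) → H.Adj a b →
      b = w ∨ b = x := by
    obtain ⟨e, ⟨i, rfl⟩, hc⟩ := hw
    have hr : ∀ j, j = i ∨ j = i + 1 := by revert i; decide
    refine ⟨e (i + 1), e.map_adj_iff.2 (by revert i; simp [k2]), ?_⟩
    rintro a b ha hab
    obtain ⟨k, rfl⟩ : b ∈ Set.range e := by
      rcases ha with rfl | rfl <;> exact hc _ _ hab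
    rcases hr k with rfl | rfl <;> simp
  have hxw : H.Adj x w := hwx.symm
  have hwH := H.edge_vert hwx
  have hxH := H.edge_vert hxw
  by_cases hy : ∃ y, G.Adj x y ∧ y ∉ H.verts
  · obtain ⟨y, hxy, hyH⟩ := hy
    have hyw : y ≠ w := by rintro rfl; exact hyH hwH
    obtain ⟨H', hH', hverts, hadj⟩ := exists_replace hH.1 (S := {w, x, y})
      (by
        rintro a b (rfl | rfl | rfl) hab
        · rcases hx _ b (Or.inl rfl) hab with rfl | rfl <;> simp
        · rcases hx _ b (Or.inr rfl) hab with rfl | rfl <;> simp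
        · exact absurd (H.edge_vert hab) hyH)
      (Subgraph.IsMatching.subgraphOfAdj hxy)
      (by rintro a (rfl | rfl) <;> simp)
    have hmem : ∀ a, a ∈ H'.verts ↔ a ∈ H.verts ∧ a ≠ w ∨ a = y := by
      intro a
      rw [hverts]
      simp only [Set.mem_union, Set.mem_sdiff, Set.mem_insert_iff, Set.mem_singleton_iff,
        subgraphOfAdj_verts]
      have := hwx.ne
      grind
    refine minMatchK2C5_induce_le (H := H) hH' ?_ ?_ (Equiv.swap y w)
      (Equiv.injective _).injOn ?_ ?_
    · simp [hmem, hyw.symm]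
    · intro u v huv hu hv
      simp only [hmem]
      have := hH.2 huv
      tauto
    · intro a ha
      rcases (hmem a).1 ha with ⟨ha, haw⟩ | rfl
      · have hay : a ≠ y := by rintro rfl; exact hyH ha
        rwa [Equiv.swap_apply_of_ne_of_ne hay haw]
      · rwa [Equiv.swap_apply_left]
    · intro a b hab
      rcases (hadj a b).1 hab with ⟨h, ha⟩ | h
      · have hb : b ≠ y ∧ b ≠ w := by
          refine ⟨?_, ?_⟩
          · rintro rfl; exact hyH (H.edge_vert h.symm)
          · rintro rfl
            rcases hx _ a (Or.inl rfl) h.symm with rfl | rfl <;> simp at ha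
        simp only [Set.mem_insert_iff, Set.mem_singleton_iff, not_or] at ha
        rwa [Equiv.swap_apply_of_ne_of_ne ha.2.2 ha.1, Equiv.swap_apply_of_ne_of_ne hb.1 hb.2]
      · have hsx : Equiv.swap y w x = x := Equiv.swap_apply_of_ne_of_ne hxy.ne hxw.adj_sub.ne
        rw [subgraphOfAdj_adj, Sym2.eq_iff] at h
        rcases h with ⟨rfl, rfl⟩ | ⟨rfl, rfl⟩
        · rw [hsx, Equiv.swap_apply_left]; exact hxw
        · rw [hsx, Equiv.swap_apply_left]; exact hwx
  · push Not at hy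
    obtain ⟨H', hH', hverts, hadj⟩ := exists_replace hH.1 (S := {w, x})
      (fun a b ha hab => hx a b ha hab) (isMatching_bot G) (by simp)
    have hmem : ∀ a, a ∈ H'.verts ↔ a ∈ H.verts ∧ a ≠ w ∧ a ≠ x := by
      intro a
      rw [hverts]
      simp
    refine minMatchK2C5_induce_le (H := H) hH' ?_ ?_ id
      Function.injective_id.injOn (fun a ha => ((hmem a).1 ha).1) ?_
    · simp [hmem]
    · intro u v huv hu hv
      simp only [hmem]
      have := hH.2 huv
      have h1 : u = x → v ∈ H.verts := by rintro rfl; exact hy v huv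
      have h2 : v = x → u ∈ H.verts := by rintro rfl; exact hy u huv.symm
      have := huv.ne
      grind
    · intro a b hab
      rcases (hadj a b).1 hab with ⟨h, -⟩ | h
      exacts [h, h.elim]

lemma minMatchK2C5_induce_le_of_inCopy_cycle5 {V : Type*} [Finite V] {G : SimpleGraph V}
    {w : V} {H : G.Subgraph} (hH : IsMaximalK2C5Subgraph G H)
    (hw : InCopy cycle5 H.spanningCoe w) :
    minMatchK2C5 (G.induce ({w}ᶜ : Set V)) ≤ matchNum H.coe := by
  obtain ⟨e, ⟨i, rfl⟩, hc⟩ := hw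
  have hsucc : ∀ j, H.Adj (e j) (e (j + 1)) := fun j => e.map_adj_iff.2 (cycle5_adj_succ j)
  have h12 := hsucc (i + 1)
  have h34 := hsucc (i + 3)
  have hmatch : (G.subgraphOfAdj h12.adj_sub ⊔ G.subgraphOfAdj h34.adj_sub).IsMatching := by
    refine (Subgraph.IsMatching.subgraphOfAdj _).sup (Subgraph.IsMatching.subgraphOfAdj _) ?_
    rw [support_subgraphOfAdj, support_subgraphOfAdj, Set.disjoint_left]
    simp only [Set.mem_insert_iff, Set.mem_singleton_iff]
    rintro a (rfl | rfl) <;> simp only [e.injective.eq_iff] <;> clear * - <;> revert i <;> decide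
  obtain ⟨H', hH', hverts, hadj⟩ := exists_replace hH.1 (S := Set.range e)
    (by rintro _ b ⟨j, rfl⟩ hab; exact hc j b hab) hmatch
    (by rintro a ((rfl | rfl) | (rfl | rfl)) <;> exact Set.mem_range_self _)
  have hmem : ∀ a, a ∈ H'.verts ↔ a ∈ H.verts ∧ a ≠ e i := by
    intro a
    rw [hverts]
    by_cases ha : a ∈ Set.range e
    · obtain ⟨j, rfl⟩ := ha
      have : e j ∈ H.verts := H.edge_vert (hsucc j)
      simp only [Set.mem_union, Set.mem_sdiff, Set.mem_range_self, not_true_eq_false, and_false,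
        false_or, Subgraph.verts_sup, subgraphOfAdj_verts, Set.mem_insert_iff,
        Set.mem_singleton_iff, e.injective.eq_iff, ne_eq, this, true_and]
      clear * -
      revert i j; decide
    · have h1 : a ≠ e i := by rintro rfl; exact ha ⟨i, rfl⟩
      have h2 : a ∉ (G.subgraphOfAdj h12.adj_sub ⊔ G.subgraphOfAdj h34.adj_sub).verts := by
        rintro ((rfl | rfl) | (rfl | rfl)) <;> exact ha (Set.mem_range_self _)
      rw [Set.mem_union, Set.mem_sdiff]
      tauto
  refine minMatchK2C5_induce_le (H := H) hH' ?_ ?_ id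
    Function.injective_id.injOn (fun a ha => ((hmem a).1 ha).1) ?_
  · simp [hmem]
  · intro u v huv hu hv
    simp only [hmem]
    have := hH.2 huv
    tauto
  · intro a b hab
    rcases (hadj a b).1 hab with ⟨h, -⟩ | h
    · exact h
    · rw [Subgraph.sup_adj, subgraphOfAdj_adj, subgraphOfAdj_adj, Sym2.eq_iff, Sym2.eq_iff] at h
      rcases h with (⟨rfl, rfl⟩ | ⟨rfl, rfl⟩) | (⟨rfl, rfl⟩ | ⟨rfl, rfl⟩)
      exacts [h12, h12.symm, h34, h34.symm]

/-- Deleting a vertex does not increase the minimum `{K₂,C₅}`-matching number. -/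
theorem stmt3 {V : Type*} [Fintype V] (G : SimpleGraph V) (w : V) :
    minMatchK2C5 (G.induce ({w}ᶜ : Set V)) ≤ minMatchK2C5 G := by
  obtain ⟨H₀, hH₀⟩ := exists_isMaximalK2C5Subgraph G
  obtain ⟨H, hH, hmin⟩ := Nat.sInf_mem
    (s := {k | ∃ H : G.Subgraph, IsMaximalK2C5Subgraph G H ∧ matchNum H.coe = k})
    ⟨_, H₀, hH₀, rfl⟩
  change _ = minMatchK2C5 G at hmin
  rw [← hmin]
  by_cases hw : w ∈ H.verts
  · rcases isK2C5Graph_coe_iff.1 hH.1 w hw with h | h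
    exacts [minMatchK2C5_induce_le_of_inCopy_k2 hH h,
      minMatchK2C5_induce_le_of_inCopy_cycle5 hH h]
  · exact minMatchK2C5_induce_le hH.1 hw (fun u v huv _ _ => hH.2 huv) id
      Function.injective_id.injOn (fun _ h => h) (fun _ _ h => h)

end Paper
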